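/- arXiv:2509.24799 — 5 statements merged into one kernel-verified Lean document; each statement's English description precedes it below -/
import Mathlib

section
/- Let n be a positive integer, p ≥ 1 a natural number, A an n×n complex matrix, and Q an n×n positive semidefinite Hermitian complex matrix. Define Q_p := Σ_{i=0}^{p-1} (A^i)^H Q A^i, where (·)^H denotes conjugate transpose. If the pair (A, Q) is observable in the PBH-kernel sense, i.e., the only vector x ∈ ℂ^n with Q (A^s x) = 0 for all natural numbers s is x = 0, then the lifted pair (A^p, Q_p) is also observable in the same sense: the only vector x ∈ ℂ^n with Q_p ((A^p)^s x) = 0 for all natural numbers s is x = 0. -/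
open Matrix Finset
open scoped ComplexOrder

theorem Matrix.PosSemidef.mulVec_eq_zero_of_conjTranspose_mul_mul {m n : Type*} [Fintype m]
    [Fintype n] {Q : Matrix m m ℂ} (hQ : Q.PosSemidef) (B : Matrix m n ℂ) {y : n → ℂ}
    (h : (Bᴴ * Q * B) *ᵥ y = 0) : Q *ᵥ (B *ᵥ y) = 0 := by
  rw [← hQ.dotProduct_mulVec_zero_iff, star_mulVec, ← dotProduct_mulVec, mulVec_mulVec,
    mulVec_mulVec, h, dotProduct_zero]

theorem Matrix.PosSemidef.mulVec_eq_zero_of_sum_mulVec_eq_zero {ι n : Type*} [Fintype n]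
    {s : Finset ι} {M : ι → Matrix n n ℂ} (hM : ∀ i ∈ s, (M i).PosSemidef) {y : n → ℂ}
    (h : (∑ i ∈ s, M i) *ᵥ y = 0) {i : ι} (hi : i ∈ s) : M i *ᵥ y = 0 := by
  have hsum : ∑ j ∈ s, star y ⬝ᵥ M j *ᵥ y = 0 := by
    rw [← dotProduct_sum, ← sum_mulVec, h, dotProduct_zero]
  rw [← (hM i hi).dotProduct_mulVec_zero_iff]
  exact (Finset.sum_eq_zero_iff_of_nonneg
    fun j hj => (hM j hj).dotProduct_mulVec_nonneg y).mp hsum i hi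

/-- If `(A, Q)` is observable in the PBH-kernel sense, then the lifted pair
`(A^p, Q_p)` with `Q_p = ∑_{i<p} (Aⁱ)ᴴ Q Aⁱ` is also observable in the same sense. -/
theorem lifted_pair_observable (n : ℕ) (hn : 0 < n) (p : ℕ) (hp : 1 ≤ p)
    (A Q : Matrix (Fin n) (Fin n) ℂ) (hQ : Q.PosSemidef)
    (hobs : ∀ x : Fin n → ℂ, (∀ s : ℕ, Q.mulVec ((A ^ s).mulVec x) = 0) → x = 0) :
    ∀ x : Fin n → ℂ,
      (∀ s : ℕ,
        (∑ i ∈ Finset.range p, (A ^ i)ᴴ * Q * A ^ i).mulVec (((A ^ p) ^ s).mulVec x) = 0) →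
      x = 0 := by
  intro x hx
  refine hobs x fun s => ?_
  have hmem : s % p ∈ Finset.range p := Finset.mem_range.mpr (Nat.mod_lt s hp)
  have hzero := hQ.mulVec_eq_zero_of_conjTranspose_mul_mul (A ^ (s % p))
    (PosSemidef.mulVec_eq_zero_of_sum_mulVec_eq_zero
      (fun i _ => hQ.conjTranspose_mul_mul_same (A ^ i)) (hx (s / p)) hmem)
  rwa [mulVec_mulVec (M := A ^ (s % p)), ← pow_mul, ← pow_add, Nat.mod_add_div] at hzero
end

section
/- Let A be a real n×n matrix, B a real n×m matrix, Q a real symmetric positive semidefinite n×n matrix, R a real symmetric positive definite m×m matrix, and p ≥ 1 a natural number. Define B_p := A^{p-1} B, Q_p := Σ_{i=0}^{p-1} (A^i)ᵀ Q A^i, S_p := Σ_{i=1}^{p-1} (A^i)ᵀ Q A^{i-1} B, and R_p := R + Σ_{i=1}^{p-1} Bᵀ (A^{i-1})ᵀ Q A^{i-1} B. Suppose (A, Q) is observable over ℝ in the PBH-kernel sense: the only x ∈ ℝ^n with Q (A^s x) = 0 for all natural numbers s is x = 0. Suppose P is a real symmetric positive semidefinite n×n matrix such that B_pᵀ P B_p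 + R_p is positive definite (hence invertible) and P satisfies the algebraic Riccati equation P = Q_p + (A^p)ᵀ P A^p − ((A^p)ᵀ P B_p + S_p)(B_pᵀ P B_p + R_p)^{-1}(B_pᵀ P A^p + S_pᵀ). Then P is positive definite. -/
open Matrix Finset

namespace Matrix

theorem dotProduct_transpose_mul_mul_mulVec {k l : Type*} [Fintype k] [Fintype l]
    (M : Matrix k k ℝ) (C : Matrix k l ℝ) (x : l → ℝ) :
    x ⬝ᵥ (Cᵀ * M * C) *ᵥ x = (C *ᵥ x) ⬝ᵥ M *ᵥ (C *ᵥ x) := by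
  rw [Matrix.mul_assoc, ← mulVec_mulVec, ← mulVec_mulVec, mulVec_transpose,
    dotProduct_comm x, ← dotProduct_mulVec, dotProduct_comm]

theorem PosSemidef.real_dotProduct_mulVec_nonneg {k : Type*} [Fintype k]
    {M : Matrix k k ℝ} (hM : M.PosSemidef) (x : k → ℝ) : 0 ≤ x ⬝ᵥ M *ᵥ x := by
  simpa using hM.dotProduct_mulVec_nonneg x

theorem PosSemidef.mulVec_eq_zero_of_dotProduct_nonpos {k : Type*} [Fintype k]
    {M : Matrix k k ℝ} (hM : M.PosSemidef) {x : k → ℝ} (hx : x ⬝ᵥ M *ᵥ x ≤ 0) : M *ᵥ x = 0 := by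
  have h := (hM.dotProduct_mulVec_zero_iff x).1
  simp only [star_trivial] at h
  exact h (le_antisymm hx (hM.real_dotProduct_mulVec_nonneg x))

theorem PosSemidef.posDef_of_mulVec_eq_zero {k : Type*} [Fintype k]
    {M : Matrix k k ℝ} (hM : M.PosSemidef) (h : ∀ x, M *ᵥ x = 0 → x = 0) : M.PosDef := by
  refine PosDef.of_dotProduct_mulVec_pos hM.isHermitian fun x hx => ?_
  by_contra hn
  exact hx (h x (hM.mulVec_eq_zero_of_dotProduct_nonpos (by simpa using hn)))

/-- Completion of squares: the lifted Riccati right-hand side equals the closed-loop cost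
of a feedback gain `F` satisfying the stationarity condition `hF`. -/
theorem lifted_riccati_eq_closed_loop {n m : Type*} [Fintype n] [DecidableEq n]
    [Fintype m] {p : ℕ} (hp : 1 ≤ p) (A : Matrix n n ℝ) (B : Matrix n m ℝ)
    {Q P : Matrix n n ℝ} (R : Matrix m m ℝ) (hQ : Qᵀ = Q)
    {Bp : Matrix n m ℝ} {Qp : Matrix n n ℝ}
    (hQp : Qp = ∑ i ∈ Finset.range p, (A ^ i)ᵀ * Q * A ^ i)
    {Sp : Matrix n m ℝ}
    (hSp : Sp = ∑ i ∈ Finset.Ico 1 p, (A ^ i)ᵀ * Q * (A ^ (i - 1) * B))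
    {Rp : Matrix m m ℝ}
    (hRp : Rp = R + ∑ i ∈ Finset.Ico 1 p, Bᵀ * (A ^ (i - 1))ᵀ * Q * (A ^ (i - 1)) * B)
    {F : Matrix m n ℝ}
    (hF : (Bpᵀ * P * Bp + Rp) * F = -(Bpᵀ * P * A ^ p + Spᵀ)) :
    Qp + (A ^ p)ᵀ * P * A ^ p + ((A ^ p)ᵀ * P * Bp + Sp) * F =
      Q + ∑ i ∈ Finset.Ico 1 p,
          (A ^ i + A ^ (i - 1) * B * F)ᵀ * Q * (A ^ i + A ^ (i - 1) * B * F) +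
        Fᵀ * R * F + (A ^ p + Bp * F)ᵀ * P * (A ^ p + Bp * F) := by
  have hQp' : Qp = Q + ∑ i ∈ Finset.Ico 1 p, (A ^ i)ᵀ * Q * A ^ i := by
    rw [hQp, Finset.range_eq_Ico, Finset.sum_eq_sum_Ico_succ_bot (by omega)]
    simp
  have hSt : Spᵀ = ∑ i ∈ Finset.Ico 1 p, (A ^ (i - 1) * B)ᵀ * Q * A ^ i := by
    rw [hSp, transpose_sum]
    refine Finset.sum_congr rfl fun i _ => ?_
    simp only [transpose_mul, transpose_transpose, hQ, Matrix.mul_assoc]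
  have hsum : ∑ i ∈ Finset.Ico 1 p,
      (A ^ i + A ^ (i - 1) * B * F)ᵀ * Q * (A ^ i + A ^ (i - 1) * B * F) =
      ∑ i ∈ Finset.Ico 1 p, (A ^ i)ᵀ * Q * A ^ i + Sp * F + Fᵀ * Spᵀ +
        Fᵀ * (Rp - R) * F := by
    rw [hSt, hSp, hRp, add_sub_cancel_left]
    simp only [Matrix.mul_sum, Matrix.sum_mul, ← Finset.sum_add_distrib]
    refine Finset.sum_congr rfl fun i _ => ?_
    simp only [transpose_add, transpose_mul, Matrix.mul_add, Matrix.add_mul, Matrix.mul_assoc]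
    abel
  have hF' := congrArg (fun X => Fᵀ * X) hF
  simp only [Matrix.mul_neg, Matrix.mul_add, Matrix.add_mul, Matrix.mul_assoc] at hF'
  rw [hsum, hQp']
  simp only [transpose_add, transpose_mul, Matrix.mul_add, Matrix.add_mul, Matrix.mul_sub,
    Matrix.sub_mul, Matrix.mul_assoc]
  rw [← sub_eq_zero] at hF' ⊢
  rw [← neg_eq_zero, ← hF']
  abel

end Matrix

/-- Under observability of `(A, Q)`, any positive semidefinite symmetric
solution `P` of the lifted algebraic Riccati equation (with `B_pᵀ P B_p + R_p` positive
definite) is positive definite. -/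
theorem riccati_solution_posDef (n m : ℕ) (p : ℕ) (hp : 1 ≤ p)
    (A : Matrix (Fin n) (Fin n) ℝ) (B : Matrix (Fin n) (Fin m) ℝ)
    (Q : Matrix (Fin n) (Fin n) ℝ) (R : Matrix (Fin m) (Fin m) ℝ)
    (hQ : Q.PosSemidef) (hR : R.PosDef)
    (hobs : ∀ x : Fin n → ℝ, (∀ s : ℕ, Q.mulVec ((A ^ s).mulVec x) = 0) → x = 0)
    (P : Matrix (Fin n) (Fin n) ℝ) (hP : P.PosSemidef)
    (Bp : Matrix (Fin n) (Fin m) ℝ) (hBp : Bp = A ^ (p - 1) * B)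
    (Qp : Matrix (Fin n) (Fin n) ℝ)
    (hQp : Qp = ∑ i ∈ Finset.range p, (A ^ i)ᵀ * Q * A ^ i)
    (Sp : Matrix (Fin n) (Fin m) ℝ)
    (hSp : Sp = ∑ i ∈ Finset.Ico 1 p, (A ^ i)ᵀ * Q * (A ^ (i - 1) * B))
    (Rp : Matrix (Fin m) (Fin m) ℝ)
    (hRp : Rp = R + ∑ i ∈ Finset.Ico 1 p, Bᵀ * (A ^ (i - 1))ᵀ * Q * (A ^ (i - 1)) * B)
    (hPD : (Bpᵀ * P * Bp + Rp).PosDef)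
    (hare : P = Qp + (A ^ p)ᵀ * P * A ^ p -
      ((A ^ p)ᵀ * P * Bp + Sp) * (Bpᵀ * P * Bp + Rp)⁻¹ * (Bpᵀ * P * A ^ p + Spᵀ)) :
    P.PosDef := by
  have hQt : Qᵀ = Q := by simpa using hQ.isHermitian.eq
  obtain ⟨F, hFdef⟩ : ∃ F, F = -((Bpᵀ * P * Bp + Rp)⁻¹ * (Bpᵀ * P * A ^ p + Spᵀ)) := ⟨_, rfl⟩
  have hF : (Bpᵀ * P * Bp + Rp) * F = -(Bpᵀ * P * A ^ p + Spᵀ) := by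
    rw [hFdef, Matrix.mul_neg,
      Matrix.mul_nonsing_inv_cancel_left _ _ ((isUnit_iff_isUnit_det _).1 hPD.isUnit)]
  have hcl := lifted_riccati_eq_closed_loop hp A B R hQt hQp hSp hRp hF
  rw [hFdef, Matrix.mul_neg, ← Matrix.mul_assoc, ← sub_eq_add_neg, ← hare, ← hFdef] at hcl
  have key : ∀ x, P *ᵥ x = 0 → (∀ i < p, Q *ᵥ (A ^ i *ᵥ x) = 0) ∧ P *ᵥ (A ^ p *ᵥ x) = 0 := by
    intro x hx
    have hsum := congrArg (fun M => x ⬝ᵥ M *ᵥ x) hcl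
    simp only [hx, dotProduct_zero, add_mulVec, sum_mulVec, dotProduct_add, dotProduct_sum,
      dotProduct_transpose_mul_mul_mulVec] at hsum
    simp only [← add_mulVec] at hsum
    have hnn : ∀ i ∈ Finset.Ico 1 p,
        0 ≤ ((A ^ i + A ^ (i - 1) * B * F) *ᵥ x) ⬝ᵥ Q *ᵥ ((A ^ i + A ^ (i - 1) * B * F) *ᵥ x) :=
      fun i _ => hQ.real_dotProduct_mulVec_nonneg _
    have h0 := hQ.real_dotProduct_mulVec_nonneg x
    have h1 := Finset.sum_nonneg hnn
    have h2 := hR.posSemidef.real_dotProduct_mulVec_nonneg (F *ᵥ x)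
    have h3 := hP.real_dotProduct_mulVec_nonneg ((A ^ p + Bp * F) *ᵥ x)
    have hFx : F *ᵥ x = 0 := by
      by_contra hne
      have := hR.dotProduct_mulVec_pos hne
      simp only [star_trivial] at this
      linarith
    have hstep : ∀ (C : Matrix (Fin n) (Fin n) ℝ) (D : Matrix (Fin n) (Fin m) ℝ),
        (C + D * F) *ᵥ x = C *ᵥ x := fun C D => by
      rw [add_mulVec, ← mulVec_mulVec, hFx, mulVec_zero, add_zero]
    refine ⟨fun i hi => ?_, ?_⟩
    · rcases Nat.eq_zero_or_pos i with rfl | hi0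
      · simpa using hQ.mulVec_eq_zero_of_dotProduct_nonpos (x := x) (by linarith)
      · have := Finset.single_le_sum hnn (Finset.mem_Ico.2 ⟨hi0, hi⟩)
        rw [← hstep (A ^ i) (A ^ (i - 1) * B)]
        exact hQ.mulVec_eq_zero_of_dotProduct_nonpos (by linarith)
    · rw [← hstep (A ^ p) Bp]
      exact hP.mulVec_eq_zero_of_dotProduct_nonpos (by linarith)
  refine hP.posDef_of_mulVec_eq_zero fun x hx => hobs x fun s => ?_
  have hiter : ∀ k, P *ᵥ (A ^ (p * k) *ᵥ x) = 0 := by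
    intro k
    induction k with
    | zero => simpa using hx
    | succ k ih =>
      have := (key _ ih).2
      rwa [mulVec_mulVec x, ← pow_add, add_comm, ← Nat.mul_succ] at this
  have := (key _ (hiter (s / p))).1 (s % p) (Nat.mod_lt _ hp)
  rwa [mulVec_mulVec x, ← pow_add, Nat.mod_add_div] at this
end

section
/- Let A be a real n×n matrix, B a real n×m matrix, Q a real symmetric n×n matrix, R a real symmetric m×m matrix, and p ≥ 1 a natural number. Define B_p := A^{p-1} B, Q_p := Σ_{i=0}^{p-1} (A^i)ᵀ Q A^i, S_p := Σ_{i=1}^{p-1} (A^i)ᵀ Q A^{i-1} B, and R_p := R + Σ_{i=1}^{p-1} Bᵀ (A^{i-1})ᵀ Q A^{i-1} B. Define the no-input backward map T₀(P) := Q + Aᵀ P A and the control backward map T_u(P) := Q + Aᵀ P A − Aᵀ P B (Bᵀ P B + R)^{-1} Bᵀ P A. Let P be any real symmetric n×n matrix, and set M := T₀^{p-1}(P) (the (p−1)-fold iterate of T₀ applied to P). Then (i) Bᵀ M B + R = B_pᵀ P B_p + R_p, and (ii) if B_pᵀ P B_p + R_p is invertible, then T_u(M) = Q_p + (A^p)ᵀ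 P A^p − ((A^p)ᵀ P B_p + S_p)(B_pᵀ P B_p + R_p)^{-1}(B_pᵀ P A^p + S_pᵀ). That is, p steps of the one-step Riccati backward recursion—control applied at the first step of the period and no control otherwise—coincide with one step of the lifted Riccati recursion. -/
open Matrix Finset

/-- The no-input one-step Riccati backward map `T₀(P) = Q + Aᵀ P A`. -/
def riccatiNoInput (n : ℕ) (A Q : Matrix (Fin n) (Fin n) ℝ) :
    Matrix (Fin n) (Fin n) ℝ → Matrix (Fin n) (Fin n) ℝ :=
  fun P => Q + Aᵀ * P * A

/-- The control one-step Riccati backward map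
`T_u(P) = Q + Aᵀ P A − Aᵀ P B (Bᵀ P B + R)⁻¹ Bᵀ P A`. -/
noncomputable def riccatiControl (n m : ℕ) (A Q : Matrix (Fin n) (Fin n) ℝ)
    (B : Matrix (Fin n) (Fin m) ℝ) (R : Matrix (Fin m) (Fin m) ℝ) :
    Matrix (Fin n) (Fin n) ℝ → Matrix (Fin n) (Fin n) ℝ :=
  fun P => Q + Aᵀ * P * A - Aᵀ * P * B * (Bᵀ * P * B + R)⁻¹ * (Bᵀ * P * A)

/-- Iterating `T₀` gives `T₀^k(P) = ∑_{i<k} (A^i)ᵀ Q A^i + (A^k)ᵀ P A^k`. -/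
theorem riccatiNoInput_iterate (n : ℕ) (A Q P : Matrix (Fin n) (Fin n) ℝ) (k : ℕ) :
    (riccatiNoInput n A Q)^[k] P =
      ∑ i ∈ Finset.range k, (A ^ i)ᵀ * Q * A ^ i + (A ^ k)ᵀ * P * A ^ k := by
  induction k with
  | zero => simp
  | succ k ih =>
    rw [Function.iterate_succ_apply', ih, Finset.sum_range_succ']
    simp only [riccatiNoInput, Matrix.mul_add, Matrix.add_mul, Finset.mul_sum, Finset.sum_mul,
      pow_succ, Matrix.transpose_mul, Matrix.mul_assoc, pow_zero, Matrix.transpose_one,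
      Matrix.one_mul, Matrix.mul_one]
    abel

/-- `p` steps of the one-step Riccati backward recursion (control applied at
the first step of the period, no control otherwise) coincide with one step of the lifted
Riccati recursion. -/
theorem periodic_riccati_lift (n m : ℕ) (p : ℕ) (hp : 1 ≤ p)
    (A : Matrix (Fin n) (Fin n) ℝ) (B : Matrix (Fin n) (Fin m) ℝ)
    (Q : Matrix (Fin n) (Fin n) ℝ) (R : Matrix (Fin m) (Fin m) ℝ)
    (hQ : Q.IsSymm) (hR : R.IsSymm)
    (P : Matrix (Fin n) (Fin n) ℝ) (hP : P.IsSymm)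
    (Bp : Matrix (Fin n) (Fin m) ℝ) (hBp : Bp = A ^ (p - 1) * B)
    (Qp : Matrix (Fin n) (Fin n) ℝ)
    (hQp : Qp = ∑ i ∈ Finset.range p, (A ^ i)ᵀ * Q * A ^ i)
    (Sp : Matrix (Fin n) (Fin m) ℝ)
    (hSp : Sp = ∑ i ∈ Finset.Ico 1 p, (A ^ i)ᵀ * Q * (A ^ (i - 1) * B))
    (Rp : Matrix (Fin m) (Fin m) ℝ)
    (hRp : Rp = R + ∑ i ∈ Finset.Ico 1 p, Bᵀ * (A ^ (i - 1))ᵀ * Q * (A ^ (i - 1)) * B)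
    (M : Matrix (Fin n) (Fin n) ℝ) (hM : M = (riccatiNoInput n A Q)^[p - 1] P) :
    Bᵀ * M * B + R = Bpᵀ * P * Bp + Rp ∧
    (IsUnit (Bpᵀ * P * Bp + Rp) →
      riccatiControl n m A Q B R M =
        Qp + (A ^ p)ᵀ * P * A ^ p -
          ((A ^ p)ᵀ * P * Bp + Sp) * (Bpᵀ * P * Bp + Rp)⁻¹ * (Bpᵀ * P * A ^ p + Spᵀ)) := by
  obtain ⟨k, rfl⟩ : ∃ k, p = k + 1 := ⟨p - 1, by omega⟩
  simp only [Nat.add_sub_cancel] at hBp hM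
  rw [riccatiNoInput_iterate] at hM
  rw [Finset.sum_Ico_eq_sum_range] at hSp hRp
  simp only [Nat.add_sub_cancel, Nat.add_sub_cancel_left] at hSp hRp
  have hgain : Bᵀ * M * B + R = Bpᵀ * P * Bp + Rp := by
    subst hBp hRp hM
    simp only [Matrix.mul_add, Matrix.add_mul, Matrix.mul_sum, Matrix.sum_mul,
      Matrix.transpose_mul, Matrix.mul_assoc]
    abel
  have hstage : Q + Aᵀ * M * A = Qp + (A ^ (k + 1))ᵀ * P * A ^ (k + 1) := by
    have h := riccatiNoInput_iterate n A Q P (k + 1)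
    rw [Function.iterate_succ_apply', riccatiNoInput_iterate, ← hM, ← hQp] at h
    exact h
  have hcross : Aᵀ * M * B = (A ^ (k + 1))ᵀ * P * Bp + Sp := by
    subst hBp hSp hM
    simp only [Matrix.mul_add, Matrix.add_mul, Matrix.mul_sum, Matrix.sum_mul,
      Matrix.transpose_mul, Matrix.mul_assoc, pow_succ, Nat.add_comm 1]
    abel
  have hMsymm : Mᵀ = M := by
    subst hM
    simp only [Matrix.transpose_add, Matrix.transpose_sum, Matrix.transpose_mul,
      Matrix.transpose_transpose, hQ.eq, hP.eq, Matrix.mul_assoc]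
  have hcross' : Bᵀ * M * A = Bpᵀ * P * A ^ (k + 1) + Spᵀ := by
    simpa only [Matrix.transpose_add, Matrix.transpose_mul, Matrix.transpose_transpose,
      hMsymm, hP.eq, Matrix.mul_assoc] using congrArg Matrix.transpose hcross
  refine ⟨hgain, fun _ => ?_⟩
  rw [riccatiControl, hstage, hcross, hcross', hgain]
end

section
/- Let A be a real n×n matrix, B a real n×m matrix, Q a real symmetric n×n matrix, R a real symmetric m×m matrix, p ≥ 1 and H ≥ 1 natural numbers, and h := H·p. Define B_p := A^{p-1} B, Q_p := Σ_{i=0}^{p-1} (A^i)ᵀ Q A^i, S_p := Σ_{i=1}^{p-1} (A^i)ᵀ Q A^{i-1} B, and R_p := R + Σ_{i=1}^{p-1} Bᵀ (A^{i-1})ᵀ Q A^{i-1} B. Let P̃ be a real symmetric n×n matrix such that B_pᵀ P̃ B_p + R_p is invertible and P̃ is a fixed point of the lifted Riccati map: P̃ = Q_p + (A^p)ᵀ P̃ A^p − ((A^p)ᵀ P̃ B_p + S_p)(B_pᵀ P̃ B_p + R_p)^{-1}(B_pᵀ P̃ A^p + S_pᵀ). Define the backward sequence P_h := P̃ and, for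 s = h−1, h−2, …, 0: P_s := Q + Aᵀ P_{s+1} A − Aᵀ P_{s+1} B (Bᵀ P_{s+1} B + R)^{-1} Bᵀ P_{s+1} A if s ≡ 0 (mod p), and P_s := Q + Aᵀ P_{s+1} A otherwise (assuming the indicated inverse exists at each application). Then P_{kp} = P̃ for every k ∈ {0, 1, …, H}; in particular P_0 = P̃. -/
open Matrix Finset

/-- The backward Riccati sequence under periodic triggering, indexed from the terminal time:
`periodicBackSeq n m A B Q R p h Pt j` represents `P_{h-j}`, with `P_h = Pt` and, going
backwards, a control (Riccati) step at times `s ≡ 0 (mod p)` and a no-input step otherwise. -/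
noncomputable def periodicBackSeq (n m : ℕ) (A Q : Matrix (Fin n) (Fin n) ℝ)
    (B : Matrix (Fin n) (Fin m) ℝ) (R : Matrix (Fin m) (Fin m) ℝ) (p h : ℕ)
    (Pt : Matrix (Fin n) (Fin n) ℝ) : ℕ → Matrix (Fin n) (Fin n) ℝ
  | 0 => Pt
  | (j + 1) =>
    let Pnext := periodicBackSeq n m A Q B R p h Pt j
    if (h - (j + 1)) % p = 0 then
      Q + Aᵀ * Pnext * A - Aᵀ * Pnext * B * (Bᵀ * Pnext * B + R)⁻¹ * (Bᵀ * Pnext * A)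
    else
      Q + Aᵀ * Pnext * A

/-- The result of `j` no-input steps started from `P`. -/
def openLoopCost {n : ℕ} (A Q P : Matrix (Fin n) (Fin n) ℝ) (j : ℕ) :
    Matrix (Fin n) (Fin n) ℝ :=
  ∑ i ∈ Finset.range j, (A ^ i)ᵀ * Q * A ^ i + (A ^ j)ᵀ * P * A ^ j

theorem openLoopCost_zero {n : ℕ} (A Q P : Matrix (Fin n) (Fin n) ℝ) :
    openLoopCost A Q P 0 = P := by
  simp [openLoopCost]

theorem openLoopCost_succ {n : ℕ} (A Q P : Matrix (Fin n) (Fin n) ℝ) (j : ℕ) :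
    openLoopCost A Q P (j + 1) = Q + Aᵀ * openLoopCost A Q P j * A := by
  simp only [openLoopCost, Finset.sum_range_succ', pow_succ, Matrix.transpose_mul, mul_add,
    add_mul, Finset.mul_sum, Finset.sum_mul, Matrix.mul_assoc, pow_zero, Matrix.transpose_one,
    Matrix.one_mul, Matrix.mul_one]
  abel

theorem openLoopCost_isSymm {n : ℕ} {A Q P : Matrix (Fin n) (Fin n) ℝ} (hQ : Q.IsSymm)
    (hP : P.IsSymm) (j : ℕ) : (openLoopCost A Q P j).IsSymm := by
  simp only [Matrix.IsSymm, openLoopCost, Matrix.transpose_add, Matrix.transpose_sum,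
    Matrix.transpose_mul, Matrix.transpose_transpose, hQ.eq, hP.eq, Matrix.mul_assoc]

theorem openLoopCost_input {n m : ℕ} (A Q P : Matrix (Fin n) (Fin n) ℝ)
    (B : Matrix (Fin n) (Fin m) ℝ) (R : Matrix (Fin m) (Fin m) ℝ) (q : ℕ) :
    Bᵀ * openLoopCost A Q P q * B + R = (A ^ q * B)ᵀ * P * (A ^ q * B) +
      (R + ∑ i ∈ Finset.Ico 1 (q + 1), Bᵀ * (A ^ (i - 1))ᵀ * Q * (A ^ (i - 1)) * B) := by
  rw [Finset.sum_Ico_eq_sum_range]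
  simp only [openLoopCost, Matrix.transpose_mul, Matrix.mul_add, Matrix.add_mul,
    Matrix.mul_sum, Matrix.sum_mul, Matrix.mul_assoc, Nat.add_sub_cancel, Nat.add_sub_cancel_left]
  abel

theorem openLoopCost_cross {n m : ℕ} (A Q P : Matrix (Fin n) (Fin n) ℝ)
    (B : Matrix (Fin n) (Fin m) ℝ) (q : ℕ) :
    Aᵀ * openLoopCost A Q P q * B = (A ^ (q + 1))ᵀ * P * (A ^ q * B) +
      ∑ i ∈ Finset.Ico 1 (q + 1), (A ^ i)ᵀ * Q * (A ^ (i - 1) * B) := by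
  rw [Finset.sum_Ico_eq_sum_range]
  simp only [openLoopCost, Matrix.transpose_mul, Matrix.mul_add, Matrix.add_mul,
    Matrix.mul_sum, Matrix.sum_mul, Matrix.mul_assoc, Nat.add_sub_cancel,
    Nat.add_comm 1, pow_succ]
  abel

/-- If `P̃` is a fixed point of the lifted Riccati map, then the backward
Riccati sequence under the periodic triggering pattern satisfies `P_{kp} = P̃` for every
`k ∈ {0, …, H}`; in particular `P_0 = P̃`. -/
theorem periodic_backward_riccati_fixed (n m : ℕ) (p H : ℕ) (hp : 1 ≤ p) (hH : 1 ≤ H)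
    (h : ℕ) (hh : h = H * p)
    (A : Matrix (Fin n) (Fin n) ℝ) (B : Matrix (Fin n) (Fin m) ℝ)
    (Q : Matrix (Fin n) (Fin n) ℝ) (R : Matrix (Fin m) (Fin m) ℝ)
    (hQ : Q.IsSymm) (hR : R.IsSymm)
    (Pt : Matrix (Fin n) (Fin n) ℝ) (hPt : Pt.IsSymm)
    (Bp : Matrix (Fin n) (Fin m) ℝ) (hBp : Bp = A ^ (p - 1) * B)
    (Qp : Matrix (Fin n) (Fin n) ℝ)
    (hQp : Qp = ∑ i ∈ Finset.range p, (A ^ i)ᵀ * Q * A ^ i)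
    (Sp : Matrix (Fin n) (Fin m) ℝ)
    (hSp : Sp = ∑ i ∈ Finset.Ico 1 p, (A ^ i)ᵀ * Q * (A ^ (i - 1) * B))
    (Rp : Matrix (Fin m) (Fin m) ℝ)
    (hRp : Rp = R + ∑ i ∈ Finset.Ico 1 p, Bᵀ * (A ^ (i - 1))ᵀ * Q * (A ^ (i - 1)) * B)
    (hinv : IsUnit (Bpᵀ * Pt * Bp + Rp))
    (hfix : Pt = Qp + (A ^ p)ᵀ * Pt * A ^ p -
      ((A ^ p)ᵀ * Pt * Bp + Sp) * (Bpᵀ * Pt * Bp + Rp)⁻¹ * (Bpᵀ * Pt * A ^ p + Spᵀ))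
    (hinvs : ∀ s < h, s % p = 0 →
      IsUnit (Bᵀ * periodicBackSeq n m A Q B R p h Pt (h - (s + 1)) * B + R)) :
    ∀ k ≤ H, periodicBackSeq n m A Q B R p h Pt (h - k * p) = Pt := by
  obtain ⟨q, rfl⟩ : ∃ q, p = q + 1 := ⟨p - 1, by omega⟩
  have hstep : Q + Aᵀ * openLoopCost A Q Pt q * A - Aᵀ * openLoopCost A Q Pt q * B *
      (Bᵀ * openLoopCost A Q Pt q * B + R)⁻¹ * (Bᵀ * openLoopCost A Q Pt q * A) = Pt := by
    have hcross : Aᵀ * openLoopCost A Q Pt q * B = (A ^ (q + 1))ᵀ * Pt * Bp + Sp := by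
      rw [openLoopCost_cross, hBp, hSp, Nat.add_sub_cancel]
    have hcross' : Bᵀ * openLoopCost A Q Pt q * A = Bpᵀ * Pt * A ^ (q + 1) + Spᵀ := by
      simpa [Matrix.transpose_mul, (openLoopCost_isSymm hQ hPt q).eq, hPt.eq,
        Matrix.mul_assoc] using congrArg Matrix.transpose hcross
    have hinput : Bᵀ * openLoopCost A Q Pt q * B + R = Bpᵀ * Pt * Bp + Rp := by
      rw [openLoopCost_input, hBp, hRp, Nat.add_sub_cancel]
    have hcost : openLoopCost A Q Pt (q + 1) = Qp + (A ^ (q + 1))ᵀ * Pt * A ^ (q + 1) := by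
      rw [openLoopCost, hQp]
    rw [hcross, hcross', hinput, ← openLoopCost_succ, hcost]
    exact hfix.symm
  have hperiod : ∀ c ≤ H, periodicBackSeq n m A Q B R (q + 1) h Pt (c * (q + 1)) = Pt := by
    intro c
    induction c with
    | zero => intro _; simp [periodicBackSeq]
    | succ c ih =>
      intro hc
      obtain ⟨d, rfl⟩ := Nat.exists_eq_add_of_le hc
      have hidle : ∀ j ≤ q, periodicBackSeq n m A Q B R (q + 1) h Pt (c * (q + 1) + j) =
          openLoopCost A Q Pt j := by
        intro j
        induction j with
        | zero => intro _; rw [openLoopCost_zero]; exact ih (by omega)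
        | succ j ihj =>
          intro hj
          have hs : h - (c * (q + 1) + j + 1) = (q - j) + d * (q + 1) := by
            have : h = c * (q + 1) + (q + 1) + d * (q + 1) := by rw [hh]; ring
            omega
          have hmod : (h - (c * (q + 1) + j + 1)) % (q + 1) ≠ 0 := by
            rw [hs, Nat.add_mul_mod_self_right, Nat.mod_eq_of_lt (by omega)]
            omega
          rw [← Nat.add_assoc, periodicBackSeq, if_neg hmod, ihj (by omega), openLoopCost_succ]
      have hmod : (h - (c * (q + 1) + q + 1)) % (q + 1) = 0 := by
        have : h = c * (q + 1) + (q + 1) + d * (q + 1) := by rw [hh]; ring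
        rw [show h - (c * (q + 1) + q + 1) = d * (q + 1) by omega, Nat.mul_mod_left]
      rw [Nat.succ_mul, ← Nat.add_assoc, periodicBackSeq, if_pos hmod, hidle q le_rfl]
      exact hstep
  intro k hk
  rw [hh, ← Nat.sub_mul, ← hh]
  exact hperiod _ (Nat.sub_le _ _)
end

section
/- Let A be a real n×n matrix, B a real n×m matrix, Q a real symmetric positive semidefinite n×n matrix, R a real symmetric positive definite m×m matrix, and p ≥ 1 a natural number. Define Q_p := Σ_{i=0}^{p-1} (A^i)ᵀ Q A^i, S_p := Σ_{i=1}^{p-1} (A^i)ᵀ Q A^{i-1} B, and R_p := R + Σ_{i=1}^{p-1} Bᵀ (A^{i-1})ᵀ Q A^{i-1} B, and c_p(x,u) := xᵀ Q_p x + 2 xᵀ S_p u + uᵀ R_p u. Then c_p(x,u) ≥ 0 for all x ∈ ℝ^n, u ∈ ℝ^m; moreover, if c_p(x,u) = 0, then u = 0 and Q (A^i x) = 0 for every i ∈ {0, 1, …, p−1}. -/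
open Matrix Finset

/-- Expansion of the quadratic form of a symmetric matrix at a sum. -/
theorem Matrix.IsSymm.add_dotProduct_mulVec_add {ι α : Type*} [Fintype ι] [CommRing α]
    {M : Matrix ι ι α} (hM : M.IsSymm) (v w : ι → α) :
    (v + w) ⬝ᵥ M *ᵥ (v + w) = v ⬝ᵥ M *ᵥ v + 2 * (v ⬝ᵥ M *ᵥ w) + w ⬝ᵥ M *ᵥ w := by
  have h : w ⬝ᵥ M *ᵥ v = v ⬝ᵥ M *ᵥ w := by
    rw [dotProduct_mulVec, ← mulVec_transpose, hM.eq, dotProduct_comm]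
  rw [mulVec_add, add_dotProduct, dotProduct_add, dotProduct_add, h]
  ring

/-- Moving the outer factors of `Cᵀ * M * D` onto the arguments of the bilinear form. -/
theorem Matrix.dotProduct_transpose_mul_mul_mulVec_s9 {ι μ ν α : Type*} [Fintype ι] [Fintype μ]
    [Fintype ν] [CommRing α] (C : Matrix ι μ α) (M : Matrix ι ι α) (D : Matrix ι ν α)
    (v : μ → α) (w : ν → α) : v ⬝ᵥ (Cᵀ * M * D) *ᵥ w = (C *ᵥ v) ⬝ᵥ M *ᵥ (D *ᵥ w) := by
  rw [← mulVec_mulVec, ← mulVec_mulVec, dotProduct_mulVec, vecMul_transpose]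

/-- The lifted stage cost is the sum of the stage costs along the trajectory. -/
theorem lifted_stage_cost_eq_sum {ι κ α : Type*} [Fintype ι] [DecidableEq ι] [Fintype κ]
    [CommRing α] {p : ℕ} (hp : 1 ≤ p) (A : Matrix ι ι α) (B : Matrix ι κ α)
    {Q : Matrix ι ι α} (hQ : Q.IsSymm) (R : Matrix κ κ α) (x : ι → α) (u : κ → α) :
    x ⬝ᵥ (∑ i ∈ Finset.range p, (A ^ i)ᵀ * Q * A ^ i) *ᵥ x +
        2 * (x ⬝ᵥ (∑ i ∈ Finset.Ico 1 p, (A ^ i)ᵀ * Q * (A ^ (i - 1) * B)) *ᵥ u) +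
        u ⬝ᵥ (R + ∑ i ∈ Finset.Ico 1 p, Bᵀ * (A ^ (i - 1))ᵀ * Q * A ^ (i - 1) * B) *ᵥ u =
      x ⬝ᵥ Q *ᵥ x +
        ∑ i ∈ Finset.Ico 1 p, (A ^ i *ᵥ x + (A ^ (i - 1) * B) *ᵥ u) ⬝ᵥ
          Q *ᵥ (A ^ i *ᵥ x + (A ^ (i - 1) * B) *ᵥ u) +
        u ⬝ᵥ R *ᵥ u := by
  have hR (i : ℕ) : Bᵀ * (A ^ (i - 1))ᵀ * Q * A ^ (i - 1) * B =
      (A ^ (i - 1) * B)ᵀ * Q * (A ^ (i - 1) * B) := by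
    rw [transpose_mul]
    simp only [Matrix.mul_assoc]
  have hrange : Finset.range p = insert 0 (Finset.Ico 1 p) := by
    ext i
    simp only [Finset.mem_range, Finset.mem_insert, Finset.mem_Ico]
    omega
  simp only [hR, hrange]
  rw [Finset.sum_insert (by simp)]
  simp only [add_mulVec, sum_mulVec, dotProduct_add, dotProduct_sum,
    hQ.add_dotProduct_mulVec_add, Finset.sum_add_distrib, ← Finset.mul_sum]
  simp only [dotProduct_transpose_mul_mul_mulVec_s9, pow_zero, one_mulVec]
  ring

/-- With `Q ⪰ 0` and `R ≻ 0`, the lifted stage cost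
`c_p(x,u) = xᵀ Q_p x + 2 xᵀ S_p u + uᵀ R_p u` is nonnegative, and it vanishes only if
`u = 0` and `Q (Aⁱ x) = 0` for every `i < p`. -/
theorem lifted_stage_cost_nonneg (n m : ℕ) (p : ℕ) (hp : 1 ≤ p)
    (A : Matrix (Fin n) (Fin n) ℝ) (B : Matrix (Fin n) (Fin m) ℝ)
    (Q : Matrix (Fin n) (Fin n) ℝ) (R : Matrix (Fin m) (Fin m) ℝ)
    (hQ : Q.PosSemidef) (hR : R.PosDef)
    (Qp : Matrix (Fin n) (Fin n) ℝ)
    (hQp : Qp = ∑ i ∈ Finset.range p, (A ^ i)ᵀ * Q * A ^ i)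
    (Sp : Matrix (Fin n) (Fin m) ℝ)
    (hSp : Sp = ∑ i ∈ Finset.Ico 1 p, (A ^ i)ᵀ * Q * (A ^ (i - 1) * B))
    (Rp : Matrix (Fin m) (Fin m) ℝ)
    (hRp : Rp = R + ∑ i ∈ Finset.Ico 1 p, Bᵀ * (A ^ (i - 1))ᵀ * Q * (A ^ (i - 1)) * B) :
    (∀ (x : Fin n → ℝ) (u : Fin m → ℝ),
      0 ≤ x ⬝ᵥ Qp.mulVec x + 2 * (x ⬝ᵥ Sp.mulVec u) + u ⬝ᵥ Rp.mulVec u) ∧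
    (∀ (x : Fin n → ℝ) (u : Fin m → ℝ),
      x ⬝ᵥ Qp.mulVec x + 2 * (x ⬝ᵥ Sp.mulVec u) + u ⬝ᵥ Rp.mulVec u = 0 →
        u = 0 ∧ ∀ i < p, Q.mulVec ((A ^ i).mulVec x) = 0) := by
  subst hQp hSp hRp
  have hsymm : Q.IsSymm := by simpa [conjTranspose_eq_transpose_of_trivial] using hQ.isHermitian
  have hQ0 (v : Fin n → ℝ) : 0 ≤ v ⬝ᵥ Q *ᵥ v := by
    simpa using hQ.dotProduct_mulVec_nonneg v
  have hR0 (v : Fin m → ℝ) : 0 ≤ v ⬝ᵥ R *ᵥ v := by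
    simpa using hR.posSemidef.dotProduct_mulVec_nonneg v
  have hQz (v : Fin n → ℝ) (hv : v ⬝ᵥ Q *ᵥ v = 0) : Q *ᵥ v = 0 :=
    (hQ.dotProduct_mulVec_zero_iff v).1 (by simpa using hv)
  have hsum (x : Fin n → ℝ) (u : Fin m → ℝ) :=
    Finset.sum_nonneg fun i (_ : i ∈ Finset.Ico 1 p) =>
      hQ0 (A ^ i *ᵥ x + (A ^ (i - 1) * B) *ᵥ u)
  refine ⟨fun x u => ?_, fun x u h => ?_⟩
  · rw [lifted_stage_cost_eq_sum hp A B hsymm R x u]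
    have := hQ0 x
    have := hR0 u
    have := hsum x u
    positivity
  · rw [lifted_stage_cost_eq_sum hp A B hsymm R x u] at h
    have hx := hQ0 x
    have hu := hR0 u
    have hs := hsum x u
    have hu0 : u = 0 := by
      by_contra hne
      have hpos : 0 < u ⬝ᵥ R *ᵥ u := by simpa using hR.dotProduct_mulVec_pos hne
      linarith
    refine ⟨hu0, fun i hi => hQz _ ?_⟩
    obtain rfl | hi0 := Nat.eq_zero_or_pos i
    · rw [pow_zero, one_mulVec]
      linarith
    · have hzero := (Finset.sum_eq_zero_iff_of_nonneg fun i _ => hQ0 _).1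
        (le_antisymm (by linarith) hs) i (Finset.mem_Ico.2 ⟨hi0, hi⟩)
      simpa [hu0] using hzero
end
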